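/- arXiv:2403.01574 — 2 statements merged into one kernel-verified Lean document; each statement's English description precedes it below -/
import Mathlib

section
/- Let K be a compact Hausdorff topological space such that the Banach space C(K, ℂ) of continuous complex-valued functions on K with the supremum norm is infinite-dimensional. Then for every λ > 1, C(K, ℂ) is an L∞,λ-space: for every finite-dimensional subspace F of C(K, ℂ) there exists a finite-dimensional subspace G of C(K, ℂ) containing F and a linear isomorphism T from G onto (Fin n → ℂ) with the supremum norm, where n = dim G, such that ‖T‖·‖T⁻¹‖ ≤ λ. -/
set_option synthInstance.maxHeartbeats 1000000
set_option maxHeartbeats 1000000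

/-- `E` is an `L∞,λ`-space. -/
def IsLinftySpace (E : Type*) [NormedAddCommGroup E] [NormedSpace ℂ E] (lam : ℝ) : Prop :=
  (¬ FiniteDimensional ℂ E) ∧
  ∀ F : Subspace ℂ E, FiniteDimensional ℂ F →
    ∃ G : Subspace ℂ E, F ≤ G ∧ FiniteDimensional ℂ G ∧
      ∃ T : G ≃L[ℂ] (Fin (Module.finrank ℂ G) → ℂ),
        ‖(T : G →L[ℂ] (Fin (Module.finrank ℂ G) → ℂ))‖ *
          ‖(T.symm : (Fin (Module.finrank ℂ G) → ℂ) →L[ℂ] G)‖ ≤ lam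

lemma linfty_of_embedding {E : Type*} [NormedAddCommGroup E] [NormedSpace ℂ E] {ι : Type*}
    [Fintype ι] (F : Subspace ℂ E) (L : (ι → ℂ) →ₗ[ℂ] E) (a b lam : ℝ) (ha : 0 ≤ a) (hb : 0 ≤ b)
    (hab : a * b ≤ lam)
    (h1 : ∀ v, ‖v‖ ≤ a * ‖L v‖) (h2 : ∀ v, ‖L v‖ ≤ b * ‖v‖) (hF : F ≤ LinearMap.range L) :
    ∃ G : Subspace ℂ E, F ≤ G ∧ FiniteDimensional ℂ G ∧
      ∃ T : G ≃L[ℂ] (Fin (Module.finrank ℂ G) → ℂ),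
        ‖(T : G →L[ℂ] (Fin (Module.finrank ℂ G) → ℂ))‖ *
          ‖(T.symm : (Fin (Module.finrank ℂ G) → ℂ) →L[ℂ] G)‖ ≤ lam := by
  have hinj : Function.Injective L := by
    rw [injective_iff_map_eq_zero]
    intro v hv
    have := h1 v
    rw [hv, norm_zero, mul_zero] at this
    exact norm_le_zero_iff.1 this
  refine ⟨LinearMap.range L, hF, inferInstance, ?_⟩
  have hcard : Fintype.card ι = Module.finrank ℂ (LinearMap.range L) := by
    rw [LinearMap.finrank_range_of_inj hinj, Module.finrank_fintype_fun_eq_card]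
  generalize Module.finrank ℂ (LinearMap.range L) = n at hcard
  let e : ι ≃ Fin n := Fintype.equivFinOfCardEq hcard
  let R : (Fin n → ℂ) ≃ₗ[ℂ] (ι → ℂ) := LinearEquiv.funCongrLeft ℂ ℂ e
  have hR : ∀ v, ‖R v‖ = ‖v‖ := by
    intro v
    apply le_antisymm
    · rw [pi_norm_le_iff_of_nonneg (norm_nonneg _)]
      intro i
      exact norm_le_pi_norm v (e i)
    · rw [pi_norm_le_iff_of_nonneg (norm_nonneg _)]
      intro i
      have := norm_le_pi_norm (R v) (e.symm i)
      simpa [R, LinearEquiv.funCongrLeft_apply, LinearMap.funLeft_apply] using this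
  let S : (Fin n → ℂ) ≃ₗ[ℂ] LinearMap.range L := R.trans (LinearEquiv.ofInjective L hinj)
  have hS : ∀ v, ((S v : LinearMap.range L) : E) = L (R v) := fun v => rfl
  refine ⟨S.symm.toContinuousLinearEquiv, ?_⟩
  refine le_trans (mul_le_mul (ContinuousLinearMap.opNorm_le_bound _ ha ?_)
    (ContinuousLinearMap.opNorm_le_bound _ hb ?_) (ContinuousLinearMap.opNorm_nonneg _) ha) hab
  · intro x
    obtain ⟨v, rfl⟩ := S.surjective x
    have := h1 (R v)
    rw [hR, ← hS] at this
    simpa using this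
  · intro v
    have := h2 (R v)
    rw [hR, ← hS] at this
    exact this

lemma exists_net {K V : Type*} [TopologicalSpace K] [CompactSpace K] [PseudoMetricSpace V]
    (Φ : K → V) (hΦ : Continuous Φ) (ε : ℝ) (hε : 0 < ε) :
    ∃ s : Finset K, (∀ x ∈ s, ∀ y ∈ s, x ≠ y → ε ≤ dist (Φ x) (Φ y)) ∧
      ∀ y, ∃ x ∈ s, dist (Φ y) (Φ x) < ε := by
  have htb : TotallyBounded (Set.range Φ) := (isCompact_range hΦ).totallyBounded
  obtain ⟨t, ht, hcov⟩ := Metric.totallyBounded_iff.1 htb (ε / 2) (by positivity)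
  have hc : ∀ x, ∃ c ∈ t, dist (Φ x) c < ε / 2 := by
    intro x
    have := hcov (Set.mem_range_self x)
    simpa using this
  choose c hct hcd using hc
  obtain ⟨m, hm⟩ := zorn_subset
    {s : Set K | s.Pairwise fun x y => ε ≤ dist (Φ x) (Φ y)} (by
      intro C hC hchain
      refine ⟨⋃₀ C, ?_, fun s hs => Set.subset_sUnion_of_mem hs⟩
      exact (Set.pairwise_sUnion hchain.directedOn).2 hC)
  have hmP := hm.prop
  have hfin : m.Finite := by
    refine Set.Finite.of_finite_image (f := c) (ht.subset ?_) ?_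
    · rintro _ ⟨x, _, rfl⟩
      exact hct x
    · intro x hx y hy hxy
      by_contra hne
      have h1 := hmP hx hy hne
      have h2 := dist_triangle_right (Φ x) (Φ y) (c x)
      have h3 := hcd x
      have h4 := hcd y
      rw [← hxy] at h4
      simp only at h1
      linarith
  refine ⟨hfin.toFinset, ?_, ?_⟩
  · intro x hx y hy hne
    exact hmP (by simpa using hx) (by simpa using hy) hne
  · intro y
    by_contra! hcon
    have hins : (insert y m) ∈ {s : Set K | s.Pairwise fun x y => ε ≤ dist (Φ x) (Φ y)} := by
      refine Set.Pairwise.insert hmP ?_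
      intro x hx _
      have := hcon x (by simpa using hx)
      exact ⟨this, by rw [dist_comm]; exact this⟩
    have hy : y ∈ m := hm.le_of_ge hins (Set.subset_insert _ _) (Set.mem_insert _ _)
    have := hcon y (by simpa using hy)
    simp at this
    linarith

lemma exists_peak {K V : Type*} [TopologicalSpace K] [CompactSpace K] [PseudoMetricSpace V]
    (Φ : K → V) (hΦ : Continuous Φ) (ε : ℝ) (hε : 0 < ε) :
    ∃ s : Finset K, ∃ φ : s → C(K, ℝ), (∀ i y, 0 ≤ φ i y) ∧ (∀ y, ∑ i, φ i y = 1) ∧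
      (∀ i : s, φ i i = 1) ∧ (∀ i j : s, i ≠ j → φ i j = 0) ∧
      ∀ i y, φ i y ≠ 0 → dist (Φ y) (Φ i) < ε := by
  obtain ⟨s, hsep, hcov⟩ := exists_net Φ hΦ ε hε
  let ψ : s → K → ℝ := fun i y => max 0 (ε - dist (Φ y) (Φ i))
  have hψ0 : ∀ i y, 0 ≤ ψ i y := fun i y => le_max_left _ _
  have hψc : ∀ i, Continuous (ψ i) := fun i => by
    simp only [ψ]; fun_prop
  have hsum : ∀ y, 0 < ∑ i, ψ i y := by
    intro y
    obtain ⟨x, hx, hxy⟩ := hcov y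
    refine Finset.sum_pos' (fun i _ => hψ0 i y) ⟨⟨x, hx⟩, Finset.mem_univ _, ?_⟩
    exact lt_max_of_lt_right (by simpa using hxy)
  have hoff : ∀ i j : s, i ≠ j → ψ i j = 0 := by
    intro i j hij
    have := hsep j j.2 i i.2 (fun h => hij (Subtype.ext h.symm))
    exact max_eq_left (by linarith)
  have hdiag : ∀ i : s, ∑ j, ψ j i = ψ i i := fun i =>
    Finset.sum_eq_single i (fun j _ hj => hoff j i hj) (by simp)
  refine ⟨s, fun i => ⟨fun y => ψ i y / ∑ j, ψ j y,
    (hψc i).div (continuous_finsetSum _ fun j _ => hψc j) fun y => (hsum y).ne'⟩, ?_, ?_, ?_, ?_, ?_⟩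
  · intro i y
    exact div_nonneg (hψ0 i y) (hsum y).le
  · intro y
    simp only [ContinuousMap.coe_mk]
    rw [← Finset.sum_div]
    exact div_self (hsum y).ne'
  · intro i
    simp only [ContinuousMap.coe_mk]
    have := hsum i
    rw [hdiag] at this ⊢
    exact div_self this.ne'
  · intro i j hij
    simp only [ContinuousMap.coe_mk]
    rw [hoff i j hij, zero_div]
  · intro i y hne
    by_contra! hcon
    apply hne
    simp only [ContinuousMap.coe_mk]
    have : ψ i y = 0 := max_eq_left (by linarith)
    rw [this, zero_div]

lemma clm_dist_bound {X : Type*} [NormedAddCommGroup X] [NormedSpace ℂ X] (A B : X →L[ℂ] ℂ)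
    (ε : ℝ) (h : dist A B < ε) (f : X) : ‖A f - B f‖ ≤ ε * ‖f‖ := by
  rw [dist_eq_norm] at h
  exact ((A - B).le_opNorm f).trans (mul_le_mul_of_nonneg_right h.le (norm_nonneg _))

/-- Approximation of a finite-dimensional subspace. -/
lemma exists_approx {K : Type*} [TopologicalSpace K] [CompactSpace K]
    (F : Subspace ℂ C(K, ℂ)) [FiniteDimensional ℂ F] (ε : ℝ) (hε : 0 < ε) :
    ∃ s : Finset K, ∃ J : (s → ℂ) →L[ℂ] C(K, ℂ), ∃ W : C(K, ℂ) →L[ℂ] (s → ℂ),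
      (∀ v, ‖J v‖ = ‖v‖) ∧ ∀ f : F, ‖(f : C(K, ℂ)) - J (W f)‖ ≤ ε * ‖f‖ := by
  let Φ : K → (F →L[ℂ] ℂ) := fun x => (ContinuousMap.evalCLM ℂ x).comp F.subtypeL
  have hΦa : ∀ x (f : F), Φ x f = (f : C(K, ℂ)) x := fun x f => rfl
  have hΦ : Continuous Φ := by
    rw [continuous_clm_apply]
    intro f
    exact (f : C(K, ℂ)).continuous
  obtain ⟨s, φ, h0, h1, hd, hoff, hsupp⟩ := exists_peak Φ hΦ ε hε
  let φc : s → C(K, ℂ) := fun i => ⟨fun y => (φ i y : ℂ), by fun_prop⟩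
  let J : (s → ℂ) →ₗ[ℂ] C(K, ℂ) := Fintype.linearCombination ℂ φc
  have hJ : ∀ v y, J v y = ∑ i, v i * (φ i y : ℂ) := by
    intro v y
    simp [J, Fintype.linearCombination_apply, φc, ContinuousMap.sum_apply]
  let W : C(K, ℂ) →L[ℂ] (s → ℂ) :=
    ContinuousLinearMap.pi fun i => ContinuousMap.evalCLM ℂ (i : K)
  have hW : ∀ f i, W f i = f i := fun f i => rfl
  refine ⟨s, LinearMap.toContinuousLinearMap J, W, ?_, ?_⟩
  · intro v
    rw [LinearMap.coe_toContinuousLinearMap']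
    apply le_antisymm
    · rw [ContinuousMap.norm_le _ (norm_nonneg _)]
      intro y
      rw [hJ]
      calc ‖∑ i, v i * (φ i y : ℂ)‖ ≤ ∑ i, ‖v i * (φ i y : ℂ)‖ := norm_sum_le _ _
        _ ≤ ∑ i, ‖v‖ * φ i y := by
          refine Finset.sum_le_sum fun i _ => ?_
          rw [norm_mul, Complex.norm_real, Real.norm_of_nonneg (h0 i y)]
          exact mul_le_mul_of_nonneg_right (norm_le_pi_norm v i) (h0 i y)
        _ = ‖v‖ := by rw [← Finset.mul_sum, h1, mul_one]
    · rw [pi_norm_le_iff_of_nonneg (norm_nonneg _)]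
      intro i
      have h := ContinuousMap.norm_coe_le_norm (J v) (i : K)
      rw [hJ, Finset.sum_eq_single i (fun j _ hj => by rw [hoff j i hj]; simp) (by simp),
        hd] at h
      simpa using h
  · intro f
    rw [LinearMap.coe_toContinuousLinearMap', ContinuousMap.norm_le _ (by positivity)]
    intro y
    have key : ∀ i : s, φ i y ≠ 0 → ‖(f : C(K, ℂ)) y - (f : C(K, ℂ)) i‖ ≤ ε * ‖f‖ := by
      intro i hz
      exact clm_dist_bound (Φ y) (Φ i) ε (hsupp i y hz) f
    generalize ε * ‖f‖ = M at key ⊢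
    have hone : (∑ i, (φ i y : ℂ)) = 1 := by exact_mod_cast h1 y
    have : ((f : C(K, ℂ)) - J (W f)) y
        = ∑ i : s, ((f : C(K, ℂ)) y - (f : C(K, ℂ)) i) * (φ i y : ℂ) := by
      simp only [sub_mul]
      rw [Finset.sum_sub_distrib, ← Finset.mul_sum, hone, mul_one, ContinuousMap.sub_apply, hJ]
      rfl
    rw [this]
    calc _ ≤ ∑ i : s, ‖((f : C(K, ℂ)) y - (f : C(K, ℂ)) i) * (φ i y : ℂ)‖ := norm_sum_le _ _
      _ ≤ ∑ i, M * φ i y := by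
        refine Finset.sum_le_sum fun i _ => ?_
        rw [norm_mul, Complex.norm_real, Real.norm_of_nonneg (h0 i y)]
        by_cases hz : φ i y = 0
        · rw [hz, mul_zero, mul_zero]
        · exact mul_le_mul_of_nonneg_right (key i hz) (h0 i y)
      _ = M := by rw [← Finset.mul_sum, h1, mul_one]

theorem stmt_7 {K : Type} [TopologicalSpace K] [CompactSpace K] [T2Space K]
    (hinf : ¬ FiniteDimensional ℂ C(K, ℂ)) :
    ∀ lam : ℝ, 1 < lam → IsLinftySpace C(K, ℂ) lam := by
  intro lam hlam
  refine ⟨hinf, fun F hFd => ?_⟩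
  have := hFd
  obtain ⟨Q, hQ⟩ := Submodule.ClosedComplemented.of_finiteDimensional F
  obtain ⟨δ, hδ⟩ : ∃ δ, δ = (lam - 1) / (lam + 1) := ⟨_, rfl⟩
  have hδ0 : 0 < δ := by rw [hδ]; apply div_pos <;> linarith
  have hδ1 : δ < 1 := by rw [hδ, div_lt_one] <;> linarith
  obtain ⟨s, J, W, hJ, hF⟩ := exists_approx F (δ / (‖Q‖ + 1)) (by positivity)
  let t : C(K, ℂ) →L[ℂ] C(K, ℂ) := (ContinuousLinearMap.id ℂ _ - J.comp W).comp (F.subtypeL.comp Q)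
  have ht : ∀ f, ‖t f‖ ≤ δ * ‖f‖ := by
    intro f
    have h1 : ‖t f‖ ≤ δ / (‖Q‖ + 1) * ‖Q f‖ := hF (Q f)
    have h2 := Q.le_opNorm f
    have hq := norm_nonneg Q
    calc ‖t f‖ ≤ δ / (‖Q‖ + 1) * ‖Q f‖ := h1
      _ ≤ δ / (‖Q‖ + 1) * ((‖Q‖ + 1) * ‖f‖) := by
        gcongr
        nlinarith [norm_nonneg f]
      _ = δ * ‖f‖ := by field_simp
  have htn : ‖t‖ < 1 := lt_of_le_of_lt (ContinuousLinearMap.opNorm_le_bound _ hδ0.le ht) hδ1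
  let A : C(K, ℂ) ≃L[ℂ] C(K, ℂ) := ContinuousLinearEquiv.unitsEquiv ℂ _ (Units.oneSub t htn)
  have hA : ∀ f, A f = f - t f := fun f => rfl
  let L : (s → ℂ) →ₗ[ℂ] C(K, ℂ) := (A.symm : C(K, ℂ) →ₗ[ℂ] C(K, ℂ)).comp (J : (s → ℂ) →ₗ[ℂ] C(K, ℂ))
  have hL : ∀ v, L v - t (L v) = J v := by
    intro v
    rw [← hA]
    exact A.apply_symm_apply (J v)
  have h1δ : 0 < 1 - δ := by linarith
  refine linfty_of_embedding F L (1 + δ) (1 / (1 - δ)) lam (by linarith) (by positivity) ?_ ?_ ?_ ?_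
  · rw [mul_one_div, div_le_iff₀ h1δ, hδ]
    have : 0 < lam + 1 := by linarith
    apply le_of_eq
    field_simp
    ring
  · intro v
    rw [← hJ v, ← hL v]
    have := norm_sub_le (L v) (t (L v))
    linarith [ht (L v)]
  · intro v
    rw [← hJ v, one_div, ← div_eq_inv_mul, le_div_iff₀ h1δ]
    have h := norm_sub_norm_le (L v) (t (L v))
    rw [hL v] at h
    linarith [ht (L v)]
  · intro f hf
    refine ⟨W f, ?_⟩
    change A.symm (J (W f)) = f
    rw [ContinuousLinearEquiv.symm_apply_eq, hA]
    have hq : ((Q f : F) : C(K, ℂ)) = f := by rw [hQ ⟨f, hf⟩]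
    have : t f = f - J (W f) := by
      change ((Q f : F) : C(K, ℂ)) - J (W ((Q f : F) : C(K, ℂ))) = _
      rw [hq]
    rw [this]; abel
end

section
/- Let λ ≥ 1 and let E be an infinite-dimensional complex Banach space that is an L∞,λ-space. Then E has the Dunford–Pettis property. -/
set_option synthInstance.maxHeartbeats 1000000
set_option maxHeartbeats 1000000

/-- A complex Banach space `X` has the Dunford–Pettis property. -/
def HasDunfordPettis (X : Type*) [NormedAddCommGroup X] [NormedSpace ℂ X] : Prop :=
  ∀ (x : ℕ → X) (f : ℕ → (X →L[ℂ] ℂ)),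
    (∀ g : X →L[ℂ] ℂ, Filter.Tendsto (fun n => g (x n)) Filter.atTop (nhds 0)) →
    (∀ Φ : (X →L[ℂ] ℂ) →L[ℂ] ℂ, Filter.Tendsto (fun n => Φ (f n)) Filter.atTop (nhds 0)) →
    Filter.Tendsto (fun n => f n (x n)) Filter.atTop (nhds 0)

open Filter Topology

theorem dp_ultralim {A F : Type*} [NormedAddCommGroup F] [ProperSpace F] (U : Ultrafilter A)
    (v : A → F) (C : ℝ) (hv : ∀ a, ‖v a‖ ≤ C) : ∃ c, Tendsto v U (𝓝 c) := by
  obtain ⟨c, -, hc⟩ := (isCompact_closedBall (0 : F) C).ultrafilter_le_nhds (U.map v)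
    (by
      rw [Ultrafilter.coe_map, le_principal_iff, mem_map]
      exact Filter.univ_mem' (fun a => by simpa using hv a))
  exact ⟨c, hc⟩

theorem dp_ultralim_clm {A V : Type*} [NormedAddCommGroup V] [NormedSpace ℂ V] (U : Ultrafilter A)
    (L : A → V →L[ℂ] ℂ) (C : ℝ) (hL : ∀ a v, ‖L a v‖ ≤ C * ‖v‖) :
    ∃ M : V →L[ℂ] ℂ, (∀ v, ‖M v‖ ≤ C * ‖v‖) ∧ ∀ v, Tendsto (fun a => L a v) U (𝓝 (M v)) := by
  choose M hM using fun v => dp_ultralim U (fun a => L a v) (C * ‖v‖) (fun a => hL a v)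
  have hb : ∀ v, ‖M v‖ ≤ C * ‖v‖ := fun v =>
    le_of_tendsto (hM v).norm (Eventually.of_forall fun a => hL a v)
  let M' : V →ₗ[ℂ] ℂ :=
    { toFun := M
      map_add' := fun v w => tendsto_nhds_unique (hM (v + w)) (by
        simpa using (hM v).add (hM w))
      map_smul' := fun c v => tendsto_nhds_unique (hM (c • v)) (by
        simpa using (hM v).const_mul c) }
  exact ⟨M'.mkContinuous C hb, hb, hM⟩

theorem dp_local {E : Type*} [NormedAddCommGroup E] [NormedSpace ℂ E]
    (lam : ℝ) (hlam : 1 ≤ lam) (hE : IsLinftySpace E lam) (s : Finset E) :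
    ∃ (m : ℕ) (e : Fin m → E) (τ : Fin m → (E →L[ℂ] ℂ)), (∀ i, ‖τ i‖ ≤ 1) ∧
      (∀ x ∈ s, ∑ i, τ i x • e i = x) ∧
      (∀ f : E →L[ℂ] ℂ, ∑ i, ‖f (e i)‖ ≤ lam * ‖f‖) := by
  obtain ⟨G, hG, hfd, T, hT⟩ := hE.2 (Submodule.span ℂ (s : Set E))
    (FiniteDimensional.span_finset ℂ s)
  have hsG : ∀ x ∈ s, x ∈ G := fun x hx => hG (Submodule.subset_span hx)
  set a : ℝ := ‖(T : G →L[ℂ] (Fin (Module.finrank ℂ G) → ℂ))‖ with ha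
  rcases eq_or_ne a 0 with h0 | h0
  · refine ⟨0, fun _ => 0, fun _ => 0, by simp, ?_, ?_⟩
    · intro x hx
      have h2 : T ⟨x, hsG x hx⟩ = 0 := by
        have h1 := (T : G →L[ℂ] (Fin (Module.finrank ℂ G) → ℂ)).le_opNorm ⟨x, hsG x hx⟩
        rw [← ha, h0, zero_mul] at h1
        exact norm_le_zero_iff.1 h1
      have h3 : (⟨x, hsG x hx⟩ : G) = 0 := by simpa using h2
      have h4 : x = 0 := by simpa using h3
      simp [h4]
    · intro f
      simp only [Finset.univ_eq_empty, Finset.sum_empty]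
      positivity
  have hapos : 0 < a := lt_of_le_of_ne (ContinuousLinearMap.opNorm_nonneg _) (Ne.symm h0)
  have hcoord : ∀ i, ∃ g : StrongDual ℂ E, (∀ x : G, g x = T x i) ∧ ‖g‖ ≤ a := by
    intro i
    obtain ⟨g, hg, hgn⟩ := exists_extension_norm_eq G
      ((ContinuousLinearMap.proj i).comp (T : G →L[ℂ] (Fin (Module.finrank ℂ G) → ℂ)))
    refine ⟨g, fun x => by simpa using hg x, ?_⟩
    rw [hgn]
    refine ContinuousLinearMap.opNorm_le_bound _ hapos.le (fun x => ?_)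
    refine le_trans ?_ ((T : G →L[ℂ] (Fin (Module.finrank ℂ G) → ℂ)).le_opNorm x)
    exact norm_le_pi_norm (T x) i
  choose g hg hgn using hcoord
  refine ⟨Module.finrank ℂ G, fun i => (a : ℂ) • ((T.symm (Pi.single i 1) : G) : E),
    fun i => (a : ℂ)⁻¹ • g i, ?_, ?_, ?_⟩
  · intro i
    rw [norm_smul, norm_inv, Complex.norm_real, Real.norm_of_nonneg hapos.le]
    calc a⁻¹ * ‖g i‖ ≤ a⁻¹ * a := by gcongr; exact hgn i
      _ = 1 := inv_mul_cancel₀ h0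
  · intro x hx
    have hac : (a : ℂ) ≠ 0 := by exact_mod_cast h0
    have h1 : ∑ i, (T ⟨x, hsG x hx⟩ i) • T.symm (Pi.single i 1) = ⟨x, hsG x hx⟩ := by
      apply T.injective
      rw [map_sum]
      simp only [map_smul, ContinuousLinearEquiv.apply_symm_apply]
      ext j
      simp [Finset.sum_apply, Pi.single_apply]
    have h2 := congrArg (fun y : G => (y : E)) h1
    simp only [Submodule.coe_sum, Submodule.coe_smul] at h2
    rw [← h2]
    refine Finset.sum_congr rfl (fun i _ => ?_)
    rw [h2, ContinuousLinearMap.smul_apply, smul_smul, smul_eq_mul, ← hg i ⟨x, hsG x hx⟩]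
    congr 1
    field_simp
  · intro f
    have hu : ∀ z : ℂ, ∃ u : ℂ, ‖u‖ ≤ 1 ∧ u * z = ‖z‖ := by
      intro z
      rcases eq_or_ne z 0 with rfl | hz
      · exact ⟨0, by simp, by simp⟩
      · have hz' : (‖z‖ : ℂ) ≠ 0 := by exact_mod_cast norm_ne_zero_iff.2 hz
        refine ⟨(‖z‖ : ℂ) / z, ?_, by field_simp⟩
        rw [norm_div, Complex.norm_real, norm_norm, div_self (norm_ne_zero_iff.2 hz)]
    choose u hu1 hu2 using hu
    set w : Fin (Module.finrank ℂ G) → ℂ := fun i =>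
      u (f ((a : ℂ) • ((T.symm (Pi.single i 1) : G) : E))) with hw
    have hwn : ‖w‖ ≤ 1 := (pi_norm_le_iff_of_nonneg zero_le_one).2 (fun i => hu1 _)
    have hsum : ((∑ i, ‖f ((a : ℂ) • ((T.symm (Pi.single i 1) : G) : E))‖ : ℝ) : ℂ)
        = f ((a : ℂ) • ((T.symm w : G) : E)) := by
      have h1 : w = ∑ i, w i • (Pi.single i 1 : Fin (Module.finrank ℂ G) → ℂ) := by
        ext j
        simp [Finset.sum_apply, Pi.single_apply]
      have h2 : T.symm w = ∑ i, w i • T.symm (Pi.single i 1) := by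
        conv_lhs => rw [h1]
        rw [map_sum]
        simp only [map_smul]
      rw [h2]
      simp only [Submodule.coe_sum, Submodule.coe_smul, Finset.smul_sum, map_sum]
      push_cast
      refine Finset.sum_congr rfl (fun i _ => ?_)
      rw [← hu2, smul_comm, f.map_smul (w i), smul_eq_mul]
    have h3 : ∑ i, ‖f ((a : ℂ) • ((T.symm (Pi.single i 1) : G) : E))‖
        = ‖f ((a : ℂ) • ((T.symm w : G) : E))‖ := by
      rw [← hsum, Complex.norm_real, Real.norm_of_nonneg]
      exact Finset.sum_nonneg (fun i _ => norm_nonneg _)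
    rw [h3]
    have h4 : ‖((T.symm w : G) : E)‖ ≤
        ‖(T.symm : (Fin (Module.finrank ℂ G) → ℂ) →L[ℂ] G)‖ := by
      have := (T.symm : (Fin (Module.finrank ℂ G) → ℂ) →L[ℂ] G).le_opNorm w
      refine le_trans this ?_
      exact mul_le_of_le_one_right (norm_nonneg _) hwn
    calc ‖f ((a : ℂ) • ((T.symm w : G) : E))‖ ≤ ‖f‖ * ‖(a : ℂ) • ((T.symm w : G) : E)‖ :=
          f.le_opNorm _
      _ = ‖f‖ * (a * ‖((T.symm w : G) : E)‖) := by
          rw [norm_smul, Complex.norm_real, Real.norm_of_nonneg hapos.le]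
      _ ≤ ‖f‖ * (a * ‖(T.symm : (Fin (Module.finrank ℂ G) → ℂ) →L[ℂ] G)‖) := by gcongr
      _ ≤ ‖f‖ * lam := by gcongr
      _ = lam * ‖f‖ := mul_comm _ _

/-- positive functional / dominated convergence -/
theorem dp_meas {E A : Type*} [NormedAddCommGroup E] [NormedSpace ℂ E] (U : Ultrafilter A)
    (m : A → ℕ) (c : ∀ a, Fin (m a) → ℝ) (τ : ∀ a, Fin (m a) → (E →L[ℂ] ℂ))
    (hτ : ∀ a i, ‖τ a i‖ ≤ 1) (hc : ∀ a i, 0 ≤ c a i) (C : ℝ) (hC : ∀ a, ∑ i, c a i ≤ C)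
    (x : ℕ → E) (hx1 : ∀ n, ‖x n‖ ≤ 1)
    (hx : ∀ g : E →L[ℂ] ℂ, Tendsto (fun n => g (x n)) atTop (𝓝 0)) :
    ∃ q : ℕ → ℝ, Tendsto q atTop (𝓝 0) ∧
      ∀ n, Tendsto (fun a => ∑ i, c a i * ‖τ a i (x n)‖) U (𝓝 (q n)) := by
  let S : Set (WeakDual ℂ E) := WeakDual.toStrongDual ⁻¹' Metric.closedBall (0 : StrongDual ℂ E) 1
  have hS : IsCompact S := WeakDual.isCompact_closedBall 0 1
  haveI : CompactSpace S := isCompact_iff_compactSpace.1 hS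
  letI : MeasurableSpace S := borel S
  haveI : BorelSpace S := ⟨rfl⟩
  let t : ∀ a, Fin (m a) → S := fun a i => ⟨StrongDual.toWeakDual (τ a i), by
    have := hτ a i
    simpa [S] using this⟩
  have hbd : ∀ φ : CompactlySupportedContinuousMap S ℝ, ∃ B, ∀ a, ‖∑ i, c a i * φ (t a i)‖ ≤ B := by
    intro φ
    obtain ⟨B, hB⟩ := (isCompact_range φ.continuous).isBounded.exists_norm_le
    have hB' : ∀ y, ‖φ y‖ ≤ max B 0 := fun y => (hB _ ⟨y, rfl⟩).trans (le_max_left _ _)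
    refine ⟨C * max B 0, fun a => ?_⟩
    calc ‖∑ i, c a i * φ (t a i)‖ ≤ ∑ i, ‖c a i * φ (t a i)‖ := norm_sum_le _ _
      _ ≤ ∑ i, c a i * max B 0 := by
          refine Finset.sum_le_sum (fun i _ => ?_)
          rw [norm_mul, Real.norm_of_nonneg (hc a i)]
          exact mul_le_mul_of_nonneg_left (hB' _) (hc a i)
      _ = (∑ i, c a i) * max B 0 := by rw [Finset.sum_mul]
      _ ≤ C * max B 0 := mul_le_mul_of_nonneg_right (hC a) (le_max_right _ _)
  choose B hB using hbd
  choose M hM using fun φ : CompactlySupportedContinuousMap S ℝ =>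
    dp_ultralim U (fun a => ∑ i, c a i * φ (t a i)) (B φ) (hB φ)
  let L : CompactlySupportedContinuousMap S ℝ →ₗ[ℝ] ℝ :=
    { toFun := M
      map_add' := fun v w => tendsto_nhds_unique (hM (v + w)) (by
        simpa [mul_add, Finset.sum_add_distrib] using (hM v).add (hM w))
      map_smul' := fun r v => tendsto_nhds_unique (hM (r • v)) (by
        simpa [Finset.mul_sum, mul_left_comm] using (hM v).const_mul r) }
  let Λ : CompactlySupportedContinuousMap S ℝ →ₚ[ℝ] ℝ := PositiveLinearMap.mk₀ L (by
    intro φ hφ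
    refine ge_of_tendsto (hM φ) (Eventually.of_forall fun a => ?_)
    exact Finset.sum_nonneg (fun i _ => mul_nonneg (hc a i) (hφ _)))
  have hcont : ∀ n, Continuous (fun y : S => ‖(y : WeakDual ℂ E) (x n)‖) := fun n =>
    ((WeakDual.eval_continuous (x n)).comp continuous_subtype_val).norm
  let X : ℕ → CompactlySupportedContinuousMap S ℝ := fun n =>
    CompactlySupportedContinuousMap.continuousMapEquiv ⟨_, hcont n⟩
  refine ⟨fun n => M (X n), ?_, fun n => hM (X n)⟩
  have hint : ∀ n, M (X n) = ∫ y, ‖(y : WeakDual ℂ E) (x n)‖ ∂(RealRMK.rieszMeasure Λ) := by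
    intro n
    exact (RealRMK.integral_rieszMeasure Λ (X n)).symm
  simp_rw [hint]
  haveI : MeasureTheory.IsFiniteMeasure (RealRMK.rieszMeasure Λ) := inferInstance
  have := MeasureTheory.tendsto_integral_of_dominated_convergence
    (μ := RealRMK.rieszMeasure Λ) (F := fun n (y : S) => ‖(y : WeakDual ℂ E) (x n)‖)
    (f := fun _ => (0 : ℝ)) (fun _ => (1 : ℝ))
    (fun n => (hcont n).measurable.aestronglyMeasurable)
    (MeasureTheory.integrable_const _)
    (fun n => Eventually.of_forall fun y => by
      rw [norm_norm]
      have hy : ‖WeakDual.toStrongDual (y : WeakDual ℂ E)‖ ≤ 1 := by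
        have h := y.2
        exact mem_closedBall_zero_iff.1 h
      have := (WeakDual.toStrongDual (y : WeakDual ℂ E)).le_opNorm (x n)
      refine this.trans ?_
      exact mul_le_one₀ hy (norm_nonneg _) (hx1 n))
    (Eventually.of_forall fun y => by
      have := (hx (WeakDual.toStrongDual (y : WeakDual ℂ E))).norm
      simpa using this)
  simpa using this

/-- gliding hump -/
theorem dp_core {E A : Type*} [NormedAddCommGroup E] [NormedSpace ℂ E] (U : Ultrafilter A)
    (m : A → ℕ) (e : ∀ a, Fin (m a) → E) (τ : ∀ a, Fin (m a) → (E →L[ℂ] ℂ))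
    (hτ : ∀ a i, ‖τ a i‖ ≤ 1) (C : ℝ)
    (hC : ∀ a, ∀ f : E →L[ℂ] ℂ, ∑ i, ‖f (e a i)‖ ≤ C * ‖f‖)
    (hrep : ∀ x : E, ∀ᶠ a in (U : Filter A), ∑ i, τ a i x • e a i = x)
    (x : ℕ → E) (hx1 : ∀ n, ‖x n‖ ≤ 1) (f : ℕ → (E →L[ℂ] ℂ)) (δ : ℝ) (hδ : 0 < δ)
    (hfx : ∀ n, δ ≤ ‖f n (x n)‖) (q : ℕ → ℕ → ℝ)
    (hq : ∀ k j, Tendsto (fun a => ∑ i, ‖f k (e a i)‖ * ‖τ a i (x j)‖) U (𝓝 (q k j)))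
    (hqs : ∀ k j, k < j → q k j ≤ δ / 16 * (1 / 2) ^ j) :
    ∃ Φ : (E →L[ℂ] ℂ) →L[ℂ] ℂ, ∀ k, δ / 4 ≤ ‖Φ (f k)‖ := by
  let S := {ψ : (E →L[ℂ] ℂ) → ℂ // ∀ t, ‖t‖ ≤ 1 → ‖ψ t‖ ≤ 1}
  have hL : ∀ ψ : S, ∃ L : (E →L[ℂ] ℂ) →L[ℂ] ℂ, (∀ g, ‖L g‖ ≤ C * ‖g‖) ∧
      ∀ g, Tendsto (fun a => ∑ i, g (e a i) * ψ.1 (τ a i)) U (𝓝 (L g)) := by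
    intro ψ
    obtain ⟨L, hL1, hL2⟩ := dp_ultralim_clm U
      (fun a => ∑ i, (ψ.1 (τ a i)) • (ContinuousLinearMap.apply ℂ ℂ (e a i))) C (by
        intro a g
        simp only [ContinuousLinearMap.sum_apply, ContinuousLinearMap.smul_apply,
          ContinuousLinearMap.apply_apply, smul_eq_mul]
        refine (norm_sum_le _ _).trans (le_trans (Finset.sum_le_sum fun i _ => ?_) (hC a g))
        rw [norm_mul]
        exact mul_le_of_le_one_left (norm_nonneg _) (ψ.2 _ (hτ a i)))
    refine ⟨L, hL1, fun g => ?_⟩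
    have := hL2 g
    simp only [ContinuousLinearMap.sum_apply, ContinuousLinearMap.smul_apply,
          ContinuousLinearMap.apply_apply, smul_eq_mul] at this
    simpa only [mul_comm] using this
  choose L hLb hLt using hL
  have htx : ∀ t : E →L[ℂ] ℂ, ‖t‖ ≤ 1 → ∀ j, ‖t (x j)‖ ≤ 1 := fun t ht j =>
    (t.le_opNorm _).trans (mul_le_one₀ ht (norm_nonneg _) (hx1 j))
  have hstep : ∀ (j : ℕ) (ψ : S), ∃ ψ' : S, δ / 2 ≤ ‖L ψ' (f j)‖ ∧
      ∀ t, ‖t‖ ≤ 1 → ‖ψ'.1 t - ψ.1 t‖ ≤ 2 * ‖t (x j)‖ := by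
    intro j ψ
    have hn1 : ∀ t : E →L[ℂ] ℂ, ‖t‖ ≤ 1 →
        ‖ψ.1 t * (1 - (‖t (x j)‖ : ℂ))‖ ≤ 1 - ‖t (x j)‖ := by
      intro t ht
      have h1 := htx t ht j
      have h2 : ‖(1 - (‖t (x j)‖ : ℂ))‖ = 1 - ‖t (x j)‖ := by
        rw [← Complex.ofReal_one, ← Complex.ofReal_sub, Complex.norm_real,
          Real.norm_of_nonneg (by linarith)]
      rw [norm_mul, h2]
      exact mul_le_of_le_one_left (by linarith) (ψ.2 t ht)
    let ψ0 : S := ⟨fun t => ψ.1 t * (1 - (‖t (x j)‖ : ℂ)), fun t ht =>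
      (hn1 t ht).trans (by linarith [norm_nonneg (t (x j))])⟩
    let ψ1 : S := ⟨fun t => ψ.1 t * (1 - (‖t (x j)‖ : ℂ)) + t (x j), fun t ht =>
      (norm_add_le _ _).trans (by linarith [hn1 t ht])⟩
    have hd0 : ∀ t, ‖t‖ ≤ 1 → ‖ψ0.1 t - ψ.1 t‖ ≤ ‖t (x j)‖ := by
      intro t ht
      have : ψ0.1 t - ψ.1 t = - (ψ.1 t * (‖t (x j)‖ : ℂ)) := by simp only [ψ0]; ring
      rw [this, norm_neg, norm_mul, Complex.norm_real, norm_norm]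
      exact mul_le_of_le_one_left (norm_nonneg _) (ψ.2 t ht)
    have hd1 : ∀ t, ‖t‖ ≤ 1 → ‖ψ1.1 t - ψ.1 t‖ ≤ 2 * ‖t (x j)‖ := by
      intro t ht
      have : ψ1.1 t - ψ.1 t = (ψ0.1 t - ψ.1 t) + t (x j) := by simp only [ψ0, ψ1]; ring
      rw [this]
      refine (norm_add_le _ _).trans ?_
      linarith [hd0 t ht]
    have hdiff : L ψ1 (f j) - L ψ0 (f j) = f j (x j) := by
      have h1 := (hLt ψ1 (f j)).sub (hLt ψ0 (f j))
      refine tendsto_nhds_unique h1 (tendsto_const_nhds.congr' ?_)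
      filter_upwards [hrep (x j)] with a ha
      conv_lhs => rw [← ha]
      rw [← Finset.sum_sub_distrib, map_sum]
      refine Finset.sum_congr rfl (fun i _ => ?_)
      rw [map_smul, smul_eq_mul]
      simp only [ψ0, ψ1]
      ring
    by_cases h : δ / 2 ≤ ‖L ψ1 (f j)‖
    · exact ⟨ψ1, h, hd1⟩
    · refine ⟨ψ0, ?_, fun t ht => (hd0 t ht).trans (by linarith [norm_nonneg (t (x j))])⟩
      have h1 := hfx j
      rw [← hdiff] at h1
      have h2 := norm_sub_le (L ψ1 (f j)) (L ψ0 (f j))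
      linarith
  choose nx hnx1 hnx2 using hstep
  let Z : S := ⟨fun _ => 0, by simp⟩
  let P : ℕ → S := fun n => Nat.rec Z (fun j ψ => nx j ψ) n
  have hP : ∀ j, P (j + 1) = nx j (P j) := fun j => rfl
  have hsm : ∀ k j, ‖L (P (j + 1)) (f k) - L (P j) (f k)‖ ≤ 2 * q k j := by
    intro k j
    refine le_of_tendsto_of_tendsto ((hLt (P (j+1)) (f k)).sub (hLt (P j) (f k))).norm
      ((hq k j).const_mul 2) (Eventually.of_forall fun a => ?_)
    simp only
    rw [← Finset.sum_sub_distrib, Finset.mul_sum]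
    refine (norm_sum_le _ _).trans (Finset.sum_le_sum fun i _ => ?_)
    rw [← mul_sub, norm_mul, hP]
    calc _ ≤ ‖f k (e a i)‖ * (2 * ‖τ a i (x j)‖) := by
          gcongr
          exact hnx2 j (P j) _ (hτ a i)
      _ = _ := by ring
  have hlow : ∀ k j, δ / 4 + δ / 4 * (1 / 2) ^ (k + 1 + j) ≤ ‖L (P (k + 1 + j)) (f k)‖ := by
    intro k j
    induction j with
    | zero =>
      have h1 : δ / 2 ≤ ‖L (P (k + 1)) (f k)‖ := hnx1 k (P k)
      have h2 : (1 / 2 : ℝ) ^ (k + 1) ≤ 1 := pow_le_one₀ (by norm_num) (by norm_num)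
      simp only [add_zero]
      nlinarith
    | succ j ih =>
      have h1 := hsm k (k + 1 + j)
      have h2 := hqs k (k + 1 + j) (by omega)
      have h3 := norm_sub_norm_le (L (P (k + 1 + j)) (f k)) (L (P (k + 1 + j + 1)) (f k))
      rw [norm_sub_rev] at h3
      rw [← add_assoc, pow_succ]
      linarith
  obtain ⟨Φ, -, hΦ⟩ := dp_ultralim_clm (Ultrafilter.of (atTop : Filter ℕ)) (fun j => L (P j)) C
    (fun j g => hLb _ g)
  refine ⟨Φ, fun k => ?_⟩
  refine ge_of_tendsto (hΦ (f k)).norm (Ultrafilter.of_le _ ?_)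
  filter_upwards [eventually_ge_atTop (k + 1)] with j hj
  obtain ⟨i, rfl⟩ := Nat.exists_eq_add_of_le hj
  refine le_trans ?_ (hlow k i)
  have : 0 ≤ δ / 4 * (1 / 2 : ℝ) ^ (k + 1 + i) := by positivity
  linarith

theorem dp_subseq (q : ℕ → ℕ → ℝ) (hq : ∀ k, Tendsto (q k) atTop (𝓝 0)) (η : ℝ) (hη : 0 < η) :
    ∃ φ : ℕ → ℕ, StrictMono φ ∧ ∀ k j, k < j → q (φ k) (φ j) ≤ η * (1 / 2) ^ j := by
  obtain ⟨φ, -, hφ⟩ := exists_seq_of_forall_finset_exists (fun _ : ℕ => True)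
    (fun a b => a < b ∧ ∀ a' ≤ a, q a' b ≤ η * (1 / 2) ^ (a + 1)) (by
      intro s _
      have h : ∀ᶠ b in atTop, ∀ a ∈ s, a < b ∧ ∀ a' ≤ a, q a' b ≤ η * (1 / 2) ^ (a + 1) := by
        rw [Filter.eventually_all_finset]
        intro a _
        refine (eventually_gt_atTop a).and ?_
        refine (Set.finite_Iic a).eventually_all.2 ?_
        intro a' _
        exact (hq a').eventually (eventually_le_nhds (by positivity))
      obtain ⟨b, hb⟩ := h.exists
      exact ⟨b, trivial, hb⟩)
  have hmono : StrictMono φ := fun a b hab => (hφ a b hab).1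
  refine ⟨φ, hmono, fun k j hkj => ?_⟩
  obtain ⟨i, rfl⟩ : ∃ i, j = i + 1 := ⟨j - 1, by omega⟩
  refine ((hφ i (i + 1) (Nat.lt_succ_self i)).2 (φ k) (hmono.monotone (by omega))).trans ?_
  have : (1 / 2 : ℝ) ^ (φ i + 1) ≤ (1 / 2) ^ (i + 1) :=
    pow_le_pow_of_le_one (by norm_num) (by norm_num) (by have := hmono.id_le i; simp at this; omega)
  exact mul_le_mul_of_nonneg_left this hη.le

theorem dp_main1 {E : Type*} [NormedAddCommGroup E] [NormedSpace ℂ E]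
    (lam : ℝ) (hlam : 1 ≤ lam) (hE : IsLinftySpace E lam) (x : ℕ → E) (f : ℕ → (E →L[ℂ] ℂ))
    (hx1 : ∀ n, ‖x n‖ ≤ 1)
    (hx : ∀ g : E →L[ℂ] ℂ, Tendsto (fun n => g (x n)) atTop (𝓝 0))
    (hf : ∀ Φ : (E →L[ℂ] ℂ) →L[ℂ] ℂ, Tendsto (fun n => Φ (f n)) atTop (𝓝 0)) :
    Tendsto (fun n => f n (x n)) atTop (𝓝 0) := by
  classical
  by_contra hcon
  obtain ⟨δ, hδ, hfr⟩ : ∃ δ > 0, ∃ᶠ n in atTop, δ ≤ ‖f n (x n)‖ := by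
    rw [Metric.tendsto_nhds] at hcon
    push Not at hcon
    obtain ⟨δ, hδ, h⟩ := hcon
    exact ⟨δ, hδ, by simpa using h⟩
  obtain ⟨φ, hφ, hφ2⟩ := extraction_of_frequently_atTop hfr
  choose m e τ hτ hrep hC using dp_local lam hlam hE
  let U : Ultrafilter (Finset E) := Ultrafilter.of atTop
  have hrepU : ∀ y : E, ∀ᶠ a in (U : Filter (Finset E)), ∑ i, τ a i y • e a i = y := by
    intro y
    refine Ultrafilter.of_le _ ?_
    filter_upwards [eventually_ge_atTop ({y} : Finset E)] with a ha
    exact hrep a y (ha (Finset.mem_singleton_self y))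
  choose q hq0 hq using fun k => dp_meas U m (fun a i => ‖f (φ k) (e a i)‖) τ hτ
    (fun a i => norm_nonneg _) (lam * ‖f (φ k)‖) (fun a => hC a _) (fun n => x (φ n))
    (fun n => hx1 _) (fun g => (hx g).comp hφ.tendsto_atTop)
  obtain ⟨θ, hθ, hθ2⟩ := dp_subseq q hq0 (δ / 16) (by positivity)
  obtain ⟨Φ, hΦ⟩ := dp_core U m e τ hτ lam hC hrepU (fun n => x (φ (θ n))) (fun n => hx1 _)
    (fun n => f (φ (θ n))) δ hδ (fun n => hφ2 _) (fun k j => q (θ k) (θ j))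
    (fun k j => hq _ _) hθ2
  have h1 := ((hf Φ).comp (hφ.comp hθ).tendsto_atTop).norm
  have h2 := ge_of_tendsto h1 (Eventually.of_forall fun k => hΦ k)
  rw [norm_zero] at h2
  linarith

theorem stmt_13 {E : Type*} [NormedAddCommGroup E] [NormedSpace ℂ E] [CompleteSpace E]
    (lam : ℝ) (hlam : 1 ≤ lam) (hE : IsLinftySpace E lam) :
    HasDunfordPettis E := by
  intro x f hx hf
  obtain ⟨M, hM⟩ := banach_steinhaus
    (g := fun n => NormedSpace.inclusionInDoubleDual ℂ E (x n)) (by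
      intro g
      obtain ⟨C, hC⟩ := (Metric.isBounded_range_of_tendsto _ (hx g)).exists_norm_le
      exact ⟨C, fun n => by simpa using hC _ ⟨n, rfl⟩⟩)
  have hM' : ∀ n, ‖x n‖ ≤ max M 1 := by
    intro n
    have h1 := hM n
    have h2 : ‖NormedSpace.inclusionInDoubleDual ℂ E (x n)‖ = ‖x n‖ :=
      (NormedSpace.inclusionInDoubleDualLi ℂ (E := E)).norm_map (x n)
    rw [h2] at h1
    exact h1.trans (le_max_left _ _)
  set R : ℝ := max M 1 with hR
  have hRpos : 0 < R := lt_of_lt_of_le one_pos (le_max_right _ _)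
  have hRc : (R : ℂ) ≠ 0 := by exact_mod_cast hRpos.ne'
  have key := dp_main1 lam hlam hE (fun n => (R : ℂ)⁻¹ • x n) f (by
      intro n
      rw [norm_smul, norm_inv, Complex.norm_real, Real.norm_of_nonneg hRpos.le]
      rw [inv_mul_le_iff₀ hRpos]
      simpa using hM' n) (by
      intro g
      simpa using (hx g).const_mul (R : ℂ)⁻¹) hf
  have := key.const_mul (R : ℂ)
  simpa [hRc] using this
end
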